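/- arXiv:math/0607450 — 6 statements merged into one kernel-verified Lean document; each statement's English description precedes it below -/
import Mathlib

section
/- Let l be an odd prime, D a finite abelian group in which every element has order a power of l, and q : D → ℚ/2ℤ a map satisfying q(n·x) = n²·q(x) for all n ∈ ℤ and x ∈ D, such that b(x,y) := q(x+y) − q(x) − q(y) is ℤ-bilinear in x and y and is non-degenerate (i.e., b(x,y) = 0 for all y ∈ D implies x = 0). Then D is the internal direct sum of finitely many cyclic subgroups D₁, …, D_k that are pairwise orthogonal with respect to b. -/
/-- If `a` in `ℚ / 2ℤ` has order exactly `l ^ (m + 1)`, then every element killed by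
`l ^ (m + 1)` is a multiple of `a`. -/
theorem exists_zsmul_eq_of_primePow_torsion {l : ℕ} (hl : l.Prime) (m : ℕ)
    (a c : ℚ ⧸ AddSubgroup.zmultiples (2 : ℚ)) (ha : l ^ m • a ≠ 0)
    (ha' : l ^ (m + 1) • a = 0) (hc : l ^ (m + 1) • c = 0) : ∃ k : ℤ, c = k • a := by
  obtain ⟨r, rfl⟩ := QuotientAddGroup.mk_surjective a
  obtain ⟨s, rfl⟩ := QuotientAddGroup.mk_surjective c
  rw [← QuotientAddGroup.mk_nsmul, QuotientAddGroup.eq_zero_iff,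
    AddSubgroup.mem_zmultiples_iff] at ha' hc
  rw [← QuotientAddGroup.mk_nsmul, Ne, QuotientAddGroup.eq_zero_iff,
    AddSubgroup.mem_zmultiples_iff] at ha
  obtain ⟨u, hu⟩ := ha'
  obtain ⟨v, hv⟩ := hc
  simp only [zsmul_eq_mul, nsmul_eq_mul, Nat.cast_pow] at hu hv ha
  have hl0 : (l : ℚ) ≠ 0 := Nat.cast_ne_zero.mpr hl.ne_zero
  have hlu : ¬ (l : ℤ) ∣ u := by
    rintro ⟨w, rfl⟩
    refine ha ⟨w, mul_left_cancel₀ hl0 ?_⟩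
    push_cast at hu
    linear_combination hu
  have hcop : IsCoprime u ((l : ℤ) ^ (m + 1)) :=
    ((Nat.prime_iff_prime_int.mp hl).coprime_iff_not_dvd.mpr hlu).symm.pow_right
  obtain ⟨α, β, h⟩ := hcop
  have hQ : (α : ℚ) * u + β * (l : ℚ) ^ (m + 1) = 1 := by exact_mod_cast h
  refine ⟨v * α, ?_⟩
  rw [← QuotientAddGroup.mk_zsmul, QuotientAddGroup.eq, AddSubgroup.mem_zmultiples_iff]
  refine ⟨-(v * β), mul_left_cancel₀ (pow_ne_zero (m + 1) hl0) ?_⟩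
  simp only [zsmul_eq_mul]
  push_cast
  linear_combination (-2 * (v : ℚ)) * hQ + (v * α : ℚ) * hu - hv

section OrthogonalBasis

variable {D A : Type*} [AddCommGroup D] [AddCommGroup A]

/-- For odd `l`, a symmetric form on `H` with a value not killed by `l ^ m` has a diagonal value
not killed by `l ^ m`, provided `l ^ (m + 1)` kills `H`. -/
theorem exists_diagonal_nsmul_ne_zero {l : ℕ} (hl : l.Prime) (hodd : l ≠ 2)
    (B : D →+ D →+ A) (hsymm : ∀ x y, B x y = B y x) (H : AddSubgroup D) (m : ℕ)
    (hkill : ∀ x ∈ H, l ^ (m + 1) • x = 0) {x y : D} (hx : x ∈ H) (hy : y ∈ H)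
    (hxy : l ^ m • B x y ≠ 0) : ∃ g ∈ H, l ^ m • B g g ≠ 0 := by
  by_contra! hcon
  refine hxy ?_
  have h := hcon (x + y) (H.add_mem hx hy)
  simp only [map_add, AddMonoidHom.add_apply, nsmul_add, hcon x hx, hcon y hy, hsymm y x] at h
  have h2 : 2 • (l ^ m • B x y) = 0 := by rw [two_nsmul]; simpa using h
  have hpow : l • (l ^ m • B x y) = 0 := by
    rw [smul_smul, ← pow_succ', ← AddMonoidHom.nsmul_apply, ← map_nsmul, hkill x hx]
    simp
  have hcop : Nat.Coprime 2 l := (Nat.coprime_primes Nat.prime_two hl).mpr hodd.symm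
  rw [← AddMonoid.addOrderOf_eq_one_iff]
  exact Nat.eq_one_of_dvd_coprimes hcop (addOrderOf_dvd_of_nsmul_eq_zero h2)
    (addOrderOf_dvd_of_nsmul_eq_zero hpow)

/-- A subgroup on which a symmetric form is non-degenerate is generated by pairwise orthogonal
elements, each spanning a cyclic subgroup on which the form is non-degenerate. -/
theorem exists_orthogonal_generators [Finite D] {l : ℕ} (hl : l.Prime) (hodd : l ≠ 2)
    (hA : ∀ (m : ℕ) (a c : A), l ^ m • a ≠ 0 → l ^ (m + 1) • a = 0 → l ^ (m + 1) • c = 0 →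
      ∃ k : ℤ, c = k • a)
    (hD : ∃ N : ℕ, ∀ x : D, l ^ N • x = 0)
    (B : D →+ D →+ A) (hsymm : ∀ x y, B x y = B y x) (H : AddSubgroup D)
    (hH : ∀ x ∈ H, (∀ y ∈ H, B x y = 0) → x = 0) :
    ∃ L : List D, L.Pairwise (fun x y => B x y = 0) ∧
      AddSubgroup.closure {x | x ∈ L} = H ∧
      ∀ g ∈ L, ∀ n : ℤ, n • B g g = 0 → n • g = 0 := by
  induction H using WellFoundedLT.induction with
  | ind H ih =>
  by_cases hbot : H = ⊥
  · exact ⟨[], by simp [hbot]⟩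
  have hex : ∃ n : ℕ, ∀ x ∈ H, l ^ n • x = 0 := hD.imp fun n h x _ => h x
  classical
  obtain ⟨m, hkill, x, hx, hmx⟩ :
      ∃ m : ℕ, (∀ x ∈ H, l ^ (m + 1) • x = 0) ∧ ∃ x ∈ H, l ^ m • x ≠ 0 := by
    rcases hn : Nat.find hex with _ | m
    · refine absurd ((AddSubgroup.eq_bot_iff_forall H).mpr fun x hx => ?_) hbot
      simpa [hn] using Nat.find_spec hex x hx
    · refine ⟨m, by simpa only [hn] using Nat.find_spec hex, ?_⟩
      have := Nat.find_min hex (m := m) (by omega)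
      push Not at this
      exact this
  obtain ⟨y, hy, hxy⟩ : ∃ y ∈ H, l ^ m • B x y ≠ 0 := by
    by_contra! hcon
    exact hmx (hH _ (H.nsmul_mem hx _) fun y hy => by
      rw [map_nsmul, AddMonoidHom.nsmul_apply, hcon y hy])
  obtain ⟨g, hg, hgg⟩ := exists_diagonal_nsmul_ne_zero hl hodd B hsymm H m hkill hx hy hxy
  have hkillB : ∀ h ∈ H, l ^ (m + 1) • B h g = 0 := fun h hh => by
    rw [← AddMonoidHom.nsmul_apply, ← map_nsmul, hkill h hh, map_zero, AddMonoidHom.zero_apply]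
  have hsplit : ∀ h ∈ H, ∃ k : ℤ, B (h - k • g) g = 0 := fun h hh => by
    obtain ⟨k, hk⟩ := hA m _ _ hgg (hkillB g hg) (hkillB h hh)
    exact ⟨k, by simp [hk]⟩
  have hmem : ∀ h, h ∈ H ⊓ (B g).ker ↔ h ∈ H ∧ B h g = 0 := fun h => by
    rw [AddSubgroup.mem_inf, AddMonoidHom.mem_ker, hsymm]
  obtain ⟨L, hpair, hclos, hnd⟩ := ih (H ⊓ (B g).ker)
    (lt_of_le_of_ne inf_le_left fun h => hgg (by
      rw [((hmem g).mp (h.symm ▸ hg)).2, smul_zero]))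
    (fun z hz hz0 => by
      obtain ⟨hzH, hzg⟩ := (hmem z).mp hz
      refine hH z hzH fun w hw => ?_
      obtain ⟨k, hk⟩ := hsplit w hw
      have := hz0 _ ((hmem _).mpr ⟨H.sub_mem hw (H.zsmul_mem hg k), hk⟩)
      simpa [hzg] using this)
  have hLmem : ∀ z ∈ L, z ∈ H ⊓ (B g).ker := fun z hz =>
    hclos ▸ AddSubgroup.subset_closure hz
  refine ⟨g :: L, List.pairwise_cons.mpr ⟨fun z hz => (hLmem z hz).2, hpair⟩, ?_, ?_⟩
  · refine le_antisymm ((AddSubgroup.closure_le _).mpr fun z hz => ?_) fun h hh => ?_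
    · rcases List.mem_cons.mp hz with rfl | hz
      · exact hg
      · exact (hLmem z hz).1
    · obtain ⟨k, hk⟩ := hsplit h hh
      have h1 : h - k • g ∈ AddSubgroup.closure {x | x ∈ g :: L} := by
        have hle : {x | x ∈ L} ⊆ {x | x ∈ g :: L} := fun z hz => List.mem_cons_of_mem g hz
        refine AddSubgroup.closure_mono hle ?_
        rw [hclos]
        exact (hmem _).mpr ⟨H.sub_mem hh (H.zsmul_mem hg k), hk⟩
      have h2 : g ∈ AddSubgroup.closure {x | x ∈ g :: L} :=
        AddSubgroup.subset_closure List.mem_cons_self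
      simpa using add_mem h1 (zsmul_mem h2 k)
  · intro z hz n hn
    rcases List.mem_cons.mp hz with rfl | hz
    · have : Fact l.Prime := ⟨hl⟩
      have hord := addOrderOf_eq_prime_pow hgg (hkillB z hg)
      rw [← addOrderOf_dvd_iff_zsmul_eq_zero, hord] at hn
      rw [← addOrderOf_dvd_iff_zsmul_eq_zero]
      exact (Int.natCast_dvd_natCast.mpr
        (addOrderOf_dvd_of_nsmul_eq_zero (hkill z hg))).trans hn
    · exact hnd z hz n hn

/-- Pairwise orthogonal elements, each spanning a subgroup on which the form is non-degenerate,
span independent subgroups. -/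
theorem iSupIndep_zmultiples_of_orthogonal {ι : Type*} (B : D →+ D →+ A) (g : ι → D)
    (horth : ∀ i j, i ≠ j → B (g i) (g j) = 0)
    (hnd : ∀ i, ∀ n : ℤ, n • B (g i) (g i) = 0 → n • g i = 0) :
    iSupIndep fun i => AddSubgroup.zmultiples (g i) := by
  intro i
  rw [AddSubgroup.disjoint_def]
  rintro _ ⟨n, rfl⟩ hx
  have hle : ⨆ (j) (_ : j ≠ i), AddSubgroup.zmultiples (g j) ≤ (B (g i)).ker :=
    iSup₂_le fun j hj => (AddSubgroup.zmultiples_le_of_mem (horth i j hj.symm))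
  have := hle hx
  simp only [AddMonoidHom.mem_ker, map_zsmul] at this
  exact hnd i n this

end OrthogonalBasis


/-- A non-degenerate finite quadratic form on a finite abelian `l`-group, `l` an odd
prime, decomposes as an orthogonal direct sum of cyclic subgroups. -/
theorem stmt4 (l : ℕ) (hl : l.Prime) (hodd : l ≠ 2)
    (D : Type) [AddCommGroup D] [Fintype D]
    (horder : ∀ x : D, ∃ m : ℕ, addOrderOf x = l ^ m)
    (q : D → ℚ ⧸ AddSubgroup.zmultiples (2 : ℚ))
    (hq : ∀ (n : ℤ) (x : D), q (n • x) = n ^ 2 • q x)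
    (b : D → D → ℚ ⧸ AddSubgroup.zmultiples (2 : ℚ))
    (hb : ∀ x y : D, b x y = q (x + y) - q x - q y)
    (hbil₁ : ∀ x y z : D, b (x + y) z = b x z + b y z)
    (hbil₂ : ∀ x y z : D, b x (y + z) = b x y + b x z)
    (hnd : ∀ x : D, (∀ y : D, b x y = 0) → x = 0) :
    ∃ (k : ℕ) (Dsub : Fin k → AddSubgroup D),
      DirectSum.IsInternal Dsub ∧
      (∀ i, ∃ g : D, Dsub i = AddSubgroup.zmultiples g) ∧
      (∀ i j, i ≠ j → ∀ x ∈ Dsub i, ∀ y ∈ Dsub j, b x y = 0) := by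
  have hsymm : ∀ x y, b x y = b y x := fun x y => by
    rw [hb, hb, add_comm y x]
    abel
  let B : D →+ D →+ ℚ ⧸ AddSubgroup.zmultiples (2 : ℚ) :=
    AddMonoidHom.mk' (fun x => AddMonoidHom.mk' (b x) (hbil₂ x))
      fun x y => AddMonoidHom.ext (hbil₁ x y)
  have hD : ∃ N : ℕ, ∀ x : D, l ^ N • x = 0 := by
    choose e he using horder
    refine ⟨Finset.univ.sup e, fun x => ?_⟩
    rw [← addOrderOf_dvd_iff_nsmul_eq_zero, he]
    exact pow_dvd_pow l (Finset.le_sup (Finset.mem_univ x))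
  obtain ⟨L, hpair, hclos, hndL⟩ := exists_orthogonal_generators hl hodd
    (exists_zsmul_eq_of_primePow_torsion hl) hD B hsymm ⊤
    (fun x _ hx => hnd x fun y => hx y trivial)
  have horth : ∀ i j : Fin L.length, i ≠ j → B (L.get i) (L.get j) = 0 := by
    intro i j hij
    rcases lt_or_gt_of_ne hij with h | h
    · exact List.pairwise_iff_get.mp hpair i j h
    · exact (hsymm _ _).trans (List.pairwise_iff_get.mp hpair j i h)
  refine ⟨L.length, fun i => AddSubgroup.zmultiples (L.get i), ?_, fun i => ⟨_, rfl⟩, ?_⟩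
  · refine ⟨(iSupIndep_zmultiples_of_orthogonal B L.get horth fun i =>
      hndL _ (L.get_mem i)).dfinsuppSumAddHom_injective, AddMonoidHom.range_eq_top.mp ?_⟩
    rw [eq_top_iff, ← hclos, AddSubgroup.closure_le]
    intro z hz
    obtain ⟨i, rfl⟩ := List.get_of_mem hz
    exact ⟨DirectSum.of (fun i => AddSubgroup.zmultiples (L.get i)) i
      ⟨L.get i, AddSubgroup.mem_zmultiples _⟩, DirectSum.coeAddMonoidHom_of _ i _⟩
  · rintro i j hij _ ⟨n, rfl⟩ _ ⟨k, rfl⟩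
    change B (n • L.get i) (k • L.get j) = 0
    rw [map_zsmul, map_zsmul, AddMonoidHom.zsmul_apply, horth i j hij, smul_zero, smul_zero]
end

section
/- Let D be a finite abelian 2-group and q : D → ℚ/2ℤ a map satisfying q(n·x) = n²·q(x) for all n ∈ ℤ and x ∈ D, such that b(x,y) := q(x+y) − q(x) − q(y) is ℤ-bilinear in x and y and is non-degenerate (i.e., b(x,y) = 0 for all y ∈ D implies x = 0). Then D is the internal direct sum of finitely many subgroups D₁, …, D_k, pairwise orthogonal with respect to b, such that each D_i is either cyclic, or is isomorphic to ℤ/2^ν ℤ × ℤ/2^ν ℤ for some ν ≥ 1 with the property that for every γ ∈ D_i the order of b(γ,γ) in ℚ/2ℤ is strictly smaller than 2^ν. -/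
/-- The subgroup `H` is cyclic, or it is isomorphic to `(ℤ/2^ν)²` with all `B γ γ`, `γ ∈ H`, of
order smaller than `2^ν`. -/
def IsCyclicOrEvenType {D A : Type*} [AddCommGroup D] [AddCommGroup A] (B : D →+ D →+ A)
    (H : AddSubgroup D) : Prop :=
  (∃ g : D, H = AddSubgroup.zmultiples g) ∨
    ∃ ν : ℕ, 1 ≤ ν ∧ Nonempty (H ≃+ (ZMod (2 ^ ν) × ZMod (2 ^ ν))) ∧
      ∀ γ ∈ H, addOrderOf (B γ γ) < 2 ^ ν

/-- In `ℚ/2ℤ`, an element of order `N` generates the `N`-torsion subgroup. -/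
theorem exists_zsmul_eq_of_addOrderOf_eq {N : ℕ} (hN : 0 < N)
    {t s : ℚ ⧸ AddSubgroup.zmultiples (2 : ℚ)} (ht : addOrderOf t = N) (hs : N • s = 0) :
    ∃ k : ℤ, s = k • t := by
  have hN0 : (N : ℚ) ≠ 0 := by positivity
  have key : ∀ a : ℚ ⧸ AddSubgroup.zmultiples (2 : ℚ), N • a = 0 →
      ∃ m : ℤ, a = m • ((2 / N : ℚ) : ℚ ⧸ AddSubgroup.zmultiples (2 : ℚ)) := by
    intro a ha
    obtain ⟨r, rfl⟩ := QuotientAddGroup.mk_surjective a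
    rw [← QuotientAddGroup.mk_nsmul, QuotientAddGroup.eq_zero_iff,
      AddSubgroup.mem_zmultiples_iff] at ha
    obtain ⟨m, hm⟩ := ha
    refine ⟨m, ?_⟩
    rw [← QuotientAddGroup.mk_zsmul]
    congr 1
    simp only [zsmul_eq_mul, nsmul_eq_mul] at hm ⊢
    field_simp
    linarith
  set e : ℚ ⧸ AddSubgroup.zmultiples (2 : ℚ) := ((2 / N : ℚ) : ℚ ⧸ AddSubgroup.zmultiples (2 : ℚ))
  have he : (N : ℤ) • e = 0 := by
    rw [← QuotientAddGroup.mk_zsmul, QuotientAddGroup.eq_zero_iff,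
      AddSubgroup.mem_zmultiples_iff]
    refine ⟨1, ?_⟩
    simp only [zsmul_eq_mul]
    push_cast
    field_simp
  obtain ⟨m, hm⟩ := key t (by rw [← ht]; exact addOrderOf_nsmul_eq_zero t)
  obtain ⟨l, hl⟩ := key s hs
  have hg : Int.gcd m N = 1 := by
    obtain ⟨m', hm'⟩ := Int.gcd_dvd_left (a := m) (b := (N : ℤ))
    obtain ⟨N', hN'⟩ := Int.gcd_dvd_right (a := m) (b := (N : ℤ))
    have h0 : N' • t = 0 := by
      rw [hm, smul_smul]
      have : N' * m = m' * N := by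
        conv_lhs => rw [hm']
        conv_rhs => rw [hN']
        ring
      rw [this, mul_smul, he, smul_zero]
    have hd := addOrderOf_dvd_iff_zsmul_eq_zero.2 h0
    rw [ht] at hd
    obtain ⟨c, hc⟩ := hd
    have h1 : (N : ℤ) * ((Int.gcd m N : ℤ) * c) = N * 1 := by
      rw [mul_left_comm, ← hc, mul_one]
      exact hN'.symm
    have h2 := mul_left_cancel₀ (by exact_mod_cast hN.ne') h1
    have h3 : ((Int.gcd m N : ℕ) : ℤ) ∣ 1 := ⟨c, h2.symm⟩
    exact Nat.dvd_one.1 (by exact_mod_cast h3)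
  have hbez := Int.gcd_eq_gcd_ab m N
  rw [hg] at hbez
  refine ⟨l * Int.gcdA m N, ?_⟩
  have : l = l * Int.gcdA m N * m + l * Int.gcdB m N * N := by
    linear_combination l * hbez
  rw [hl, hm, smul_smul]
  conv_lhs => rw [this]
  rw [add_smul, mul_smul _ (N : ℤ), he, smul_zero, add_zero]

section Decomposition

variable {D A : Type*} [AddCommGroup D] [AddCommGroup A] (B : D →+ D →+ A)

/-- A cyclic subgroup generated by `γ` splits off orthogonally when `B γ γ` generates all values
`B z γ`. -/
theorem exists_orthogonal_sub_zmultiples {γ z : D} {k : ℤ} (h : B z γ = k • B γ γ) :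
    ∃ g ∈ AddSubgroup.zmultiples γ, ∀ w ∈ AddSubgroup.zmultiples γ, B (z - g) w = 0 := by
  refine ⟨k • γ, AddSubgroup.zsmul_mem_zmultiples γ k, ?_⟩
  rintro w ⟨m, rfl⟩
  simp [h, smul_comm m k]

/-- Two elements `x`, `y` killed by `2^n` such that `B x y` has order `2^n` while `B x x` and
`B y y` are even multiples of it span a copy of `(ℤ/2^n)²` that splits off orthogonally. -/
theorem exists_hyperbolic_like_subgroup {n : ℕ} {x y : D} {t : A} {r s : ℤ}
    (hx : (2 ^ n : ℕ) • x = 0) (hy : (2 ^ n : ℕ) • y = 0) (ht : addOrderOf t = 2 ^ n)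
    (hxy : B x y = t) (hyx : B y x = t) (hxx : B x x = (2 * r) • t) (hyy : B y y = (2 * s) • t) :
    ∃ H : AddSubgroup D, x ∈ H ∧ (∀ E : AddSubgroup D, x ∈ E → y ∈ E → H ≤ E) ∧
      Nonempty (H ≃+ (ZMod (2 ^ n) × ZMod (2 ^ n))) ∧
      ∀ z, (∃ k : ℤ, B z x = k • t) → (∃ l : ℤ, B z y = l • t) →
        ∃ h ∈ H, ∀ w ∈ H, B (z - h) w = 0 := by
  have hcop : IsCoprime (4 * r * s - 1) ((2 ^ n : ℕ) : ℤ) := by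
    push_cast
    exact IsCoprime.pow_right ⟨-1, 2 * r * s, by ring⟩
  have htz : ∀ a : ℤ, a • t = 0 ↔ ((2 ^ n : ℕ) : ℤ) ∣ a := by
    intro a
    rw [← addOrderOf_dvd_iff_zsmul_eq_zero, ht]
  let f : ZMod (2 ^ n) × ZMod (2 ^ n) →+ D :=
    (ZMod.lift (2 ^ n) ⟨zmultiplesHom D x, (natCast_zsmul x _).trans hx⟩).coprod
      (ZMod.lift (2 ^ n) ⟨zmultiplesHom D y, (natCast_zsmul y _).trans hy⟩)
  have hf : ∀ a c : ℤ, f ((a : ZMod (2 ^ n)), (c : ZMod (2 ^ n))) = a • x + c • y := by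
    intro a c
    simp [f]
  have hsurj : ∀ p : ZMod (2 ^ n) × ZMod (2 ^ n), ∃ a c : ℤ, p = ((a : ZMod _), (c : ZMod _)) := by
    rintro ⟨p, p'⟩
    obtain ⟨a, rfl⟩ := ZMod.intCast_surjective p
    obtain ⟨c, rfl⟩ := ZMod.intCast_surjective p'
    exact ⟨a, c, rfl⟩
  have hinj : Function.Injective f := by
    rw [injective_iff_map_eq_zero]
    intro p hp
    obtain ⟨a, c, rfl⟩ := hsurj p
    rw [hf] at hp
    have h1 : (2 * r * a + c) • t = 0 := by
      have : B (a • x + c • y) x = 0 := by simp [hp]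
      rw [← this]
      simp only [map_add, map_zsmul, AddMonoidHom.add_apply, AddMonoidHom.zsmul_apply, hxx, hyx]
      module
    have h2 : (a + 2 * s * c) • t = 0 := by
      have : B (a • x + c • y) y = 0 := by simp [hp]
      rw [← this]
      simp only [map_add, map_zsmul, AddMonoidHom.add_apply, AddMonoidHom.zsmul_apply, hxy, hyy]
      module
    rw [htz] at h1 h2
    have ha : ((2 ^ n : ℕ) : ℤ) ∣ a := by
      refine hcop.symm.dvd_of_dvd_mul_left (y := 4 * r * s - 1) ?_
      convert dvd_sub (h1.mul_left (2 * s)) h2 using 1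
      ring
    have hc : ((2 ^ n : ℕ) : ℤ) ∣ c := by
      refine hcop.symm.dvd_of_dvd_mul_left (y := 4 * r * s - 1) ?_
      convert dvd_sub (h2.mul_left (2 * r)) h1 using 1
      ring
    rw [← ZMod.intCast_zmod_eq_zero_iff_dvd] at ha hc
    simp [ha, hc]
  refine ⟨f.range, ⟨(((1 : ℤ) : ZMod _), ((0 : ℤ) : ZMod _)), by rw [hf]; simp⟩, ?_,
    ⟨(AddMonoidHom.ofInjective hinj).symm⟩, ?_⟩
  · rintro E hxE hyE _ ⟨p, rfl⟩
    obtain ⟨a, c, rfl⟩ := hsurj p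
    rw [hf]
    exact add_mem (zsmul_mem hxE a) (zsmul_mem hyE c)
  · rintro z ⟨k, hk⟩ ⟨l, hl⟩
    obtain ⟨u, v, huv⟩ := hcop
    have hN : ((2 ^ n : ℕ) : ℤ) • t = 0 := (htz _).2 dvd_rfl
    have hzx : B (z - ((u * (2 * s * k - l)) • x + (u * (2 * r * l - k)) • y)) x = 0 := by
      simp only [map_add, map_sub, map_zsmul, AddMonoidHom.add_apply, AddMonoidHom.sub_apply,
        AddMonoidHom.zsmul_apply, hxx, hyx, hk]
      have : k - ((u * (2 * s * k - l)) * (2 * r) + u * (2 * r * l - k)) =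
          (k * v) * ((2 ^ n : ℕ) : ℤ) := by linear_combination (-k) * huv
      rw [← smul_zero (k * v), ← hN, smul_smul (k * v), ← this]
      module
    have hzy : B (z - ((u * (2 * s * k - l)) • x + (u * (2 * r * l - k)) • y)) y = 0 := by
      simp only [map_add, map_sub, map_zsmul, AddMonoidHom.add_apply, AddMonoidHom.sub_apply,
        AddMonoidHom.zsmul_apply, hxy, hyy, hl]
      have : l - (u * (2 * s * k - l) + (u * (2 * r * l - k)) * (2 * s)) =
          (l * v) * ((2 ^ n : ℕ) : ℤ) := by linear_combination (-l) * huv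
      rw [← smul_zero (l * v), ← hN, smul_smul (l * v), ← this]
      module
    refine ⟨_, ⟨_, hf (u * (2 * s * k - l)) (u * (2 * r * l - k))⟩, ?_⟩
    rintro _ ⟨p, rfl⟩
    obtain ⟨a, c, rfl⟩ := hsurj p
    rw [hf, map_add, map_zsmul, map_zsmul, hzx, hzy]
    simp

/-- A nontrivial subgroup on which `B` is non-degenerate contains a nontrivial orthogonal summand
which is cyclic or of even type. -/
theorem exists_cyclic_or_even_summand (hsymm : ∀ x y, B x y = B y x)
    (htors : ∀ (N : ℕ) (t s : A), 0 < N → addOrderOf t = N → N • s = 0 → ∃ k : ℤ, s = k • t)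
    {E : AddSubgroup D} {n : ℕ} (hE : ∀ z ∈ E, (2 ^ (n + 1) : ℕ) • z = 0)
    (hnd : ∀ x ∈ E, (∀ y ∈ E, B x y = 0) → x = 0)
    {x : D} (hxE : x ∈ E) (hx : (2 ^ n : ℕ) • x ≠ 0) :
    ∃ H ≤ E, H ≠ ⊥ ∧ IsCyclicOrEvenType B H ∧
      ∀ z ∈ E, ∃ h ∈ H, ∀ w ∈ H, B (z - h) w = 0 := by
  have hN : 0 < 2 ^ (n + 1) := by positivity
  have hBtors : ∀ z ∈ E, ∀ w, (2 ^ (n + 1) : ℕ) • B z w = 0 := by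
    intro z hz w
    rw [← AddMonoidHom.nsmul_apply, ← map_nsmul, hE z hz]
    simp
  have horder : ∀ z ∈ E, ∀ w, (2 ^ n : ℕ) • B z w ≠ 0 → addOrderOf (B z w) = 2 ^ (n + 1) :=
    fun z hz w h => addOrderOf_eq_prime_pow h (hBtors z hz w)
  by_cases hγ : ∃ γ ∈ E, (2 ^ n : ℕ) • B γ γ ≠ 0
  · obtain ⟨γ, hγE, hγ⟩ := hγ
    refine ⟨AddSubgroup.zmultiples γ, by simpa using hγE, ?_, Or.inl ⟨γ, rfl⟩, ?_⟩
    · rw [Ne, AddSubgroup.zmultiples_eq_bot]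
      rintro rfl
      simp at hγ
    · intro z hz
      obtain ⟨k, hk⟩ := htors _ _ _ hN (horder γ hγE γ hγ) (hBtors z hz γ)
      exact exists_orthogonal_sub_zmultiples B hk
  · push Not at hγ
    obtain ⟨y, hyE, hy⟩ : ∃ y ∈ E, (2 ^ n : ℕ) • B x y ≠ 0 := by
      by_contra! h
      refine hx (hnd _ (nsmul_mem hxE _) fun y hy => ?_)
      rw [map_nsmul, AddMonoidHom.nsmul_apply, h y hy]
    have ht := horder x hxE y hy
    have heven : ∀ z ∈ E, ∃ r : ℤ, B z z = (2 * r) • B x y := by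
      intro z hz
      obtain ⟨k, hk⟩ := htors _ _ _ hN ht (hBtors z hz z)
      have h0 := hγ z hz
      rw [hk, ← natCast_zsmul, smul_smul, ← addOrderOf_dvd_iff_zsmul_eq_zero, ht] at h0
      push_cast at h0
      rw [pow_succ] at h0
      obtain ⟨r, rfl⟩ := (mul_dvd_mul_iff_left (by positivity)).1 h0
      exact ⟨r, hk⟩
    obtain ⟨r, hr⟩ := heven x hxE
    obtain ⟨s, hs⟩ := heven y hyE
    obtain ⟨H, hxH, hHE, hiso, hperp⟩ := exists_hyperbolic_like_subgroup B (hE x hxE) (hE y hyE) ht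
      rfl (hsymm y x) hr hs
    have hle := hHE E hxE hyE
    refine ⟨H, hle, ?_, Or.inr ⟨n + 1, by omega, hiso, fun γ hγH => ?_⟩, fun z hz => hperp z
      (htors _ _ _ hN ht (hBtors z hz x)) (htors _ _ _ hN ht (hBtors z hz y))⟩
    · rintro rfl
      rw [AddSubgroup.mem_bot] at hxH
      simp [hxH] at hx
    · refine (Nat.le_of_dvd (by positivity)
        (addOrderOf_dvd_of_nsmul_eq_zero (hγ γ (hle hγH)))).trans_lt ?_
      exact Nat.pow_lt_pow_right (by norm_num) (by omega)

/-- A non-degenerate symmetric form on a finite `2`-group, with values in a group with cyclic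
torsion, is an orthogonal sum of cyclic subgroups and subgroups of even type. -/
theorem exists_orthogonal_decomposition [Finite D] (hsymm : ∀ x y, B x y = B y x)
    (htors : ∀ (N : ℕ) (t s : A), 0 < N → addOrderOf t = N → N • s = 0 → ∃ k : ℤ, s = k • t)
    (horder : ∀ x : D, ∃ m : ℕ, addOrderOf x = 2 ^ m) (E : AddSubgroup D)
    (hnd : ∀ x ∈ E, (∀ y ∈ E, B x y = 0) → x = 0) :
    ∃ (k : ℕ) (S : Fin k → AddSubgroup D), ⨆ i, S i = E ∧
      (∀ i j, i ≠ j → ∀ x ∈ S i, ∀ y ∈ S j, B x y = 0) ∧ ∀ i, IsCyclicOrEvenType B (S i) := by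
  induction E using WellFoundedLT.induction with
  | ind E ih =>
  by_cases hbot : E = ⊥
  · exact ⟨0, Fin.elim0, by simp [hbot], fun i => i.elim0, fun i => i.elim0⟩
  obtain ⟨x, hxE, hxmax⟩ := (Set.toFinite (E : Set D)).exists_maximalFor addOrderOf _
    ⟨0, E.zero_mem⟩
  have hle : ∀ z ∈ E, addOrderOf z ≤ addOrderOf x := by
    intro z hz
    by_contra! h
    exact absurd (hxmax hz h.le) (not_le.2 h)
  obtain ⟨m, hm⟩ := horder x
  have hE : ∀ z ∈ E, (2 ^ m : ℕ) • z = 0 := by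
    intro z hz
    obtain ⟨l, hl⟩ := horder z
    rw [← addOrderOf_dvd_iff_nsmul_eq_zero, hl]
    refine Nat.pow_dvd_pow 2 ((Nat.pow_le_pow_iff_right (by norm_num : 1 < 2)).1 ?_)
    rw [← hl, ← hm]
    exact hle z hz
  obtain _ | n := m
  · exact absurd ((AddSubgroup.eq_bot_iff_forall E).2 fun z hz => by simpa using hE z hz) hbot
  have hx : (2 ^ n : ℕ) • x ≠ 0 := by
    rw [Ne, ← addOrderOf_dvd_iff_nsmul_eq_zero, hm, Nat.pow_dvd_pow_iff_le_right (by norm_num)]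
    omega
  obtain ⟨H, hHE, hH, htype, hperp⟩ :=
    exists_cyclic_or_even_summand B hsymm htors hE hnd hxE hx
  let F : AddSubgroup D :=
    { carrier := {z | z ∈ E ∧ ∀ w ∈ H, B z w = 0}
      zero_mem' := ⟨E.zero_mem, by simp⟩
      add_mem' := fun ha hb => ⟨add_mem ha.1 hb.1, fun w hw => by simp [ha.2 w hw, hb.2 w hw]⟩
      neg_mem' := fun ha => ⟨neg_mem ha.1, fun w hw => by simp [ha.2 w hw]⟩ }
  have hFE : F ≤ E := fun z hz => hz.1
  have hsplit : ∀ z ∈ E, ∃ h ∈ H, ∃ w ∈ F, z = h + w := by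
    intro z hz
    obtain ⟨h, hh, hw⟩ := hperp z hz
    exact ⟨h, hh, z - h, ⟨sub_mem hz (hHE hh), hw⟩, by abel⟩
  have hFne : F ≠ E := by
    rintro hFE'
    refine hH ((AddSubgroup.eq_bot_iff_forall H).2 fun z hz => hnd z (hHE hz) fun y hy => ?_)
    rw [hsymm]
    rw [← hFE'] at hy
    exact hy.2 z hz
  obtain ⟨k, S, hsup, horth, hS⟩ := ih F (lt_of_le_of_ne hFE hFne) fun z hz hz' => by
    refine hnd z hz.1 fun y hy => ?_
    obtain ⟨h, hh, w, hw, rfl⟩ := hsplit y hy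
    rw [map_add, hz.2 h hh, hz' w hw, add_zero]
  have hSF : ∀ i, S i ≤ F := fun i => hsup ▸ le_iSup S i
  refine ⟨k + 1, Fin.cons H S, ?_, ?_, ?_⟩
  · refine le_antisymm (iSup_le (Fin.cases hHE fun i => (hSF i).trans hFE)) fun z hz => ?_
    obtain ⟨h, hh, w, hw, rfl⟩ := hsplit z hz
    rw [← hsup] at hw
    refine add_mem (AddSubgroup.mem_iSup_of_mem 0 hh) ?_
    have hle : ⨆ i, S i ≤ ⨆ i, (Fin.cons H S : Fin (k + 1) → AddSubgroup D) i :=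
      iSup_le fun i => le_iSup (Fin.cons H S : Fin (k + 1) → AddSubgroup D) i.succ
    exact hle hw
  · intro i j
    refine Fin.cases ?_ (fun i => ?_) i <;> refine Fin.cases ?_ (fun j => ?_) j
    · simp
    · intro _ x hx y hy
      rw [hsymm]
      exact (hSF j hy).2 x hx
    · intro _ x hx y hy
      exact (hSF i hx).2 y hy
    · intro hij
      exact horth i j (by simpa using hij)
  · exact Fin.cases htype hS

/-- An orthogonal family of subgroups spanning a non-degenerate space is a direct sum. -/
theorem isInternal_of_orthogonal {ι : Type*} [DecidableEq ι] (hsymm : ∀ x y, B x y = B y x)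
    (hnd : ∀ x, (∀ y, B x y = 0) → x = 0) {S : ι → AddSubgroup D} (hsup : ⨆ i, S i = ⊤)
    (horth : ∀ i j, i ≠ j → ∀ x ∈ S i, ∀ y ∈ S j, B x y = 0) : DirectSum.IsInternal S := by
  have hind : iSupIndep S := by
    intro i
    rw [AddSubgroup.disjoint_def]
    intro z hz hz'
    refine hnd z fun y => ?_
    have hi : ∀ y ∈ S i, B z y = 0 := by
      intro y hy
      have : ⨆ j, ⨆ (_ : j ≠ i), S j ≤ (B y).ker :=
        iSup₂_le fun j hj w hw => horth i j hj.symm y hy w hw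
      rw [hsymm]
      exact this hz'
    have : ⨆ j, S j ≤ (B z).ker := by
      refine iSup_le fun j w hw => ?_
      by_cases hj : i = j
      · subst hj
        exact hi w hw
      · exact horth i j hj z hz w hw
    rw [hsup] at this
    exact this (AddSubgroup.mem_top y)
  refine ⟨hind.dfinsuppSumAddHom_injective, ?_⟩
  rw [← AddMonoidHom.range_eq_top, eq_top_iff, ← hsup]
  exact iSup_le fun i z hz =>
    ⟨DirectSum.of (fun i => S i) i ⟨z, hz⟩, DirectSum.coeAddMonoidHom_of S i ⟨z, hz⟩⟩

end Decomposition

/-- A non-degenerate finite quadratic form on a finite abelian `2`-group decomposes as an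
orthogonal direct sum of subgroups each of which is either cyclic or of even type, i.e.
isomorphic to `ℤ/2^ν × ℤ/2^ν` with the order of `b(γ,γ)` strictly smaller than `2^ν` for
every element `γ`. -/
theorem stmt5 (D : Type) [AddCommGroup D] [Fintype D]
    (horder : ∀ x : D, ∃ m : ℕ, addOrderOf x = 2 ^ m)
    (q : D → ℚ ⧸ AddSubgroup.zmultiples (2 : ℚ))
    (hq : ∀ (n : ℤ) (x : D), q (n • x) = n ^ 2 • q x)
    (b : D → D → ℚ ⧸ AddSubgroup.zmultiples (2 : ℚ))
    (hb : ∀ x y : D, b x y = q (x + y) - q x - q y)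
    (hbil₁ : ∀ x y z : D, b (x + y) z = b x z + b y z)
    (hbil₂ : ∀ x y z : D, b x (y + z) = b x y + b x z)
    (hnd : ∀ x : D, (∀ y : D, b x y = 0) → x = 0) :
    ∃ (k : ℕ) (Dsub : Fin k → AddSubgroup D),
      DirectSum.IsInternal Dsub ∧
      (∀ i j, i ≠ j → ∀ x ∈ Dsub i, ∀ y ∈ Dsub j, b x y = 0) ∧
      (∀ i, (∃ g : D, Dsub i = AddSubgroup.zmultiples g) ∨
        (∃ ν : ℕ, 1 ≤ ν ∧
          Nonempty ((Dsub i) ≃+ (ZMod (2 ^ ν) × ZMod (2 ^ ν))) ∧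
          ∀ γ ∈ Dsub i, addOrderOf (b γ γ) < 2 ^ ν)) := by
  let B : D →+ D →+ ℚ ⧸ AddSubgroup.zmultiples (2 : ℚ) :=
    AddMonoidHom.mk' (fun x => AddMonoidHom.mk' (b x) (hbil₂ x)) fun x y => by
      ext z
      exact hbil₁ x y z
  have hsymm : ∀ x y, B x y = B y x := by
    intro x y
    change b x y = b y x
    rw [hb, hb, add_comm x y]
    abel
  obtain ⟨k, S, hsup, horth, hS⟩ := exists_orthogonal_decomposition B hsymm
    (fun N t s hN ht hs => exists_zsmul_eq_of_addOrderOf_eq hN ht hs) horder ⊤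
    fun x _ h => hnd x fun y => h y (AddSubgroup.mem_top y)
  exact ⟨k, S, isInternal_of_orthogonal B hsymm hnd hsup horth, horth, hS⟩
end

section
/- Let p be a prime, let L be a finitely generated free module over the ring ℤ_p of p-adic integers equipped with a symmetric bilinear form B : L × L → ℤ_p, let ν ≥ 0 be an integer, and let v ∈ L be such that B(v,w) ∈ p^ν ℤ_p for all w ∈ L and p^{−ν} B(v,v) is a unit of ℤ_p. Then L is the internal direct sum of the submodule ℤ_p·v and the submodule {w ∈ L : B(v,w) = 0}. -/
/-- If `f v` is nonzero and divides every value of `f`, then the domain of the functional `f` is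
the internal direct sum of the span of `v` and the kernel of `f`. -/
theorem isCompl_span_singleton_ker {R M : Type*} [CommRing R] [IsDomain R] [AddCommGroup M]
    [Module R M] (f : M →ₗ[R] R) (v : M) (hv : f v ≠ 0) (hdvd : ∀ w, f v ∣ f w) :
    IsCompl (Submodule.span R {v}) (LinearMap.ker f) := by
  refine ⟨Submodule.disjoint_def.mpr fun x hx hker => ?_,
    codisjoint_iff.mpr (eq_top_iff.mpr fun w _ => ?_)⟩
  · obtain ⟨a, rfl⟩ := Submodule.mem_span_singleton.mp hx
    have ha : a = 0 := by simpa [hv] using hker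
    simp [ha]
  · obtain ⟨c, hc⟩ := hdvd w
    refine Submodule.mem_sup.mpr ⟨c • v, Submodule.smul_mem _ c (Submodule.mem_span_singleton_self v),
      w - c • v, ?_, add_sub_cancel _ _⟩
    simp [hc, mul_comm]

/-- Splitting lemma over `ℤ_p`: if `B(v,·)` is divisible by `p^ν` and `p^{-ν} B(v,v)` is
a unit, then `L` is the internal direct sum of `ℤ_p·v` and its orthogonal complement. -/
theorem stmt6 (p : ℕ) [Fact p.Prime] (L : Type) [AddCommGroup L] [Module ℤ_[p] L]
    [Module.Free ℤ_[p] L] [Module.Finite ℤ_[p] L]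
    (B : L →ₗ[ℤ_[p]] L →ₗ[ℤ_[p]] ℤ_[p]) (hsymm : ∀ x y : L, B x y = B y x)
    (ν : ℕ) (v : L)
    (hdvd : ∀ w : L, (p : ℤ_[p]) ^ ν ∣ B v w)
    (hunit : ∃ u : ℤ_[p], IsUnit u ∧ B v v = (p : ℤ_[p]) ^ ν * u) :
    IsCompl (Submodule.span ℤ_[p] {v}) (LinearMap.ker (B v)) := by
  obtain ⟨u, hu, huv⟩ := hunit
  refine isCompl_span_singleton_ker (B v) v ?_ fun w => ?_
  · rw [huv]
    exact mul_ne_zero (pow_ne_zero _ (Nat.cast_ne_zero.mpr (Fact.out : p.Prime).ne_zero)) hu.ne_zero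
  · rw [huv, hu.mul_right_dvd]
    exact hdvd w
end

section
/- Let L be a finitely generated free module over the ring ℤ₂ of 2-adic integers equipped with a symmetric bilinear form B : L × L → ℤ₂, let ν ≥ 0 be an integer, and let v₁, v₂ ∈ L be such that: B(v_i, w) ∈ 2^ν ℤ₂ for all w ∈ L and i = 1,2; B(v₁,v₁) ∈ 2^{ν+1} ℤ₂; B(v₂,v₂) ∈ 2^{ν+1} ℤ₂; and 2^{−ν} B(v₁,v₂) is a unit of ℤ₂. Then L is the internal direct sum of the submodule spanned by v₁ and v₂ and the submodule {w ∈ L : B(v₁,w) = 0 and B(v₂,w) = 0}. -/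
/-- Over `ℤ₂`, a matrix `[[2a, u], [u, 2b]]` with `u` a unit has unit determinant. -/
theorem isUnit_even_gram_det (a b : ℤ_[2]) {u : ℤ_[2]} (hu : IsUnit u) :
    IsUnit (2 * a * (2 * b) - u ^ 2) := by
  have two_not_unit : ¬ IsUnit (2 : ℤ_[2]) := by
    simpa using (PadicInt.prime_p (p := 2)).not_isUnit
  have hsum : IsUnit ((2 * a * (2 * b) - u ^ 2) + 2 * (-(2 * a * b))) := by
    have h : (2 * a * (2 * b) - u ^ 2) + 2 * (-(2 * a * b)) = -u ^ 2 := by ring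
    rw [h]
    exact (hu.pow 2).neg
  exact (IsLocalRing.isUnit_or_isUnit_of_isUnit_add hsum).resolve_right
    fun h => two_not_unit (isUnit_of_mul_isUnit_left h)

/-- Splitting lemma over `ℤ₂`: if `B(vᵢ,·)` is divisible by `2^ν`, the values `B(vᵢ,vᵢ)`
are divisible by `2^{ν+1}`, and `2^{-ν} B(v₁,v₂)` is a unit, then `L` is the internal
direct sum of the span of `v₁, v₂` and their common orthogonal complement. -/
theorem stmt7 (L : Type) [AddCommGroup L] [Module ℤ_[2] L]
    [Module.Free ℤ_[2] L] [Module.Finite ℤ_[2] L]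
    (B : L →ₗ[ℤ_[2]] L →ₗ[ℤ_[2]] ℤ_[2]) (hsymm : ∀ x y : L, B x y = B y x)
    (ν : ℕ) (v₁ v₂ : L)
    (hdvd₁ : ∀ w : L, (2 : ℤ_[2]) ^ ν ∣ B v₁ w)
    (hdvd₂ : ∀ w : L, (2 : ℤ_[2]) ^ ν ∣ B v₂ w)
    (hv₁ : (2 : ℤ_[2]) ^ (ν + 1) ∣ B v₁ v₁)
    (hv₂ : (2 : ℤ_[2]) ^ (ν + 1) ∣ B v₂ v₂)
    (hunit : ∃ u : ℤ_[2], IsUnit u ∧ B v₁ v₂ = (2 : ℤ_[2]) ^ ν * u) :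
    IsCompl (Submodule.span ℤ_[2] {v₁, v₂})
      (LinearMap.ker (B v₁) ⊓ LinearMap.ker (B v₂)) := by
  obtain ⟨u, hu, h₁₂⟩ := hunit
  obtain ⟨a, h₁₁⟩ := hv₁
  obtain ⟨b, h₂₂⟩ := hv₂
  have h₂₁ : B v₂ v₁ = 2 ^ ν * u := by rw [hsymm, h₁₂]
  obtain ⟨e, he⟩ := (isUnit_even_gram_det a b hu).exists_right_inv
  have hpow : (2 : ℤ_[2]) ^ ν ≠ 0 := pow_ne_zero _ two_ne_zero
  constructor
  · rw [Submodule.disjoint_def]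
    rintro x hx ⟨hx₁, hx₂⟩
    obtain ⟨s, t, rfl⟩ := Submodule.mem_span_pair.mp hx
    simp only [SetLike.mem_coe, LinearMap.mem_ker, map_add, map_smul, smul_eq_mul,
      h₁₁, h₁₂, h₂₁, h₂₂] at hx₁ hx₂
    have eq₁ : 2 * a * s + u * t = 0 :=
      (mul_eq_zero.mp (by linear_combination hx₁ :
        (2 : ℤ_[2]) ^ ν * (2 * a * s + u * t) = 0)).resolve_left hpow
    have eq₂ : u * s + 2 * b * t = 0 :=
      (mul_eq_zero.mp (by linear_combination hx₂ :
        (2 : ℤ_[2]) ^ ν * (u * s + 2 * b * t) = 0)).resolve_left hpow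
    have hs : s = 0 := by linear_combination e * (2 * b * eq₁ - u * eq₂) - s * he
    have ht : t = 0 := by linear_combination e * (2 * a * eq₂ - u * eq₁) - t * he
    simp [hs, ht]
  · rw [codisjoint_iff, Submodule.eq_top_iff']
    intro w
    obtain ⟨p, hp⟩ := hdvd₁ w
    obtain ⟨q, hq⟩ := hdvd₂ w
    let s := e * (2 * b * p - u * q)
    let t := e * (2 * a * q - u * p)
    refine Submodule.mem_sup.mpr ⟨s • v₁ + t • v₂, Submodule.mem_span_pair.mpr ⟨s, t, rfl⟩,
      w - (s • v₁ + t • v₂), ⟨?_, ?_⟩, add_sub_cancel _ _⟩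
    all_goals
      simp only [SetLike.mem_coe, LinearMap.mem_ker, map_sub, map_add, map_smul, smul_eq_mul,
        h₁₁, h₁₂, h₂₁, h₂₂, hp, hq, s, t]
    · linear_combination -(2 ^ ν * p) * he
    · linear_combination -(2 ^ ν * q) * he
end

section
/- Let C be an 𝔽₂-linear subspace of 𝔽₂^16 of dimension at least 5 such that the Hamming weight wt(w) of every word w ∈ C satisfies wt(w) ≡ 0 (mod 4) and wt(w) ≠ 4. Then C contains a word of weight 16; that is, the all-ones vector (1,1,…,1) belongs to C. -/
/-- The nontrivial additive character of `ZMod 2`, with values in `ℤ`. -/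
def binarySign (x : ZMod 2) : ℤ := if x = 0 then 1 else -1

lemma binarySign_add (x y : ZMod 2) : binarySign (x + y) = binarySign x * binarySign y := by
  revert x y; decide

/-- The character sum of a linear functional over `ZMod 2` is nonnegative. -/
lemma sum_binarySign_nonneg {V : Type*} [AddCommGroup V] [Module (ZMod 2) V] [Fintype V]
    (f : V →ₗ[ZMod 2] ZMod 2) : 0 ≤ ∑ v, binarySign (f v) := by
  by_cases h : ∃ u, f u ≠ 0
  · obtain ⟨u, hu⟩ := h
    have translate : ∑ v, binarySign (f (v + u)) = ∑ v, binarySign (f v) :=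
      Equiv.sum_comp (Equiv.addRight u) fun v => binarySign (f v)
    have hsign : binarySign (f u) = -1 := if_neg hu
    simp only [map_add, binarySign_add, hsign, ← Finset.sum_mul] at translate
    linarith
  · push Not at h
    simp [h, binarySign]

lemma sum_binarySign_eq {ι : Type*} [Fintype ι] (w : ι → ZMod 2) :
    ∑ i, binarySign (w i) =
      Fintype.card ι - 2 * ((Finset.univ.filter fun i => w i ≠ 0).card : ℤ) := by
  have h (x : ZMod 2) : binarySign x = 1 - 2 * (if x ≠ 0 then 1 else 0) := by
    revert x; decide
  simp only [h, Finset.sum_sub_distrib, ← Finset.mul_sum, Finset.sum_boole]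
  simp

/-- The second moment of the character sums over a code is at least its diagonal part. -/
lemma card_mul_card_le_sum_sq {ι : Type*} [Fintype ι] (C : Submodule (ZMod 2) (ι → ZMod 2))
    [Fintype C] :
    (Fintype.card ι * Fintype.card C : ℤ) ≤ ∑ w : C, (∑ i, binarySign (w.1 i)) ^ 2 := by
  classical
  have expand : ∑ w : C, (∑ i, binarySign (w.1 i)) ^ 2 =
      ∑ i, ∑ j, ∑ w : C, binarySign (w.1 i + w.1 j) := by
    simp only [sq, Finset.sum_mul_sum, binarySign_add]
    rw [Finset.sum_comm]
    exact Finset.sum_congr rfl fun i _ => Finset.sum_comm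
  have diagonal (i : ι) : (Fintype.card C : ℤ) ≤
      ∑ j, ∑ w : C, binarySign (w.1 i + w.1 j) := by
    have hi : ∑ w : C, binarySign (w.1 i + w.1 i) = Fintype.card C := by
      simp [CharTwo.add_self_eq_zero, binarySign]
    rw [← hi]
    refine Finset.single_le_sum (f := fun j => ∑ w : C, binarySign (w.1 i + w.1 j))
      (fun j _ => ?_) (Finset.mem_univ i)
    let coord (k : ι) : (ι → ZMod 2) →ₗ[ZMod 2] ZMod 2 := LinearMap.proj k
    let f := coord i + coord j
    have hf (w : C) : (f ∘ₗ C.subtype) w = w.1 i + w.1 j := rfl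
    simpa only [hf] using sum_binarySign_nonneg (f ∘ₗ C.subtype)
  rw [expand]
  simpa using Finset.sum_le_sum fun i (_ : i ∈ Finset.univ) => diagonal i

/-- A binary linear code of length 16 and dimension ≥ 5 in which every word has weight
divisible by 4 and no word has weight 4 contains the all-ones word (of weight 16). -/
theorem stmt10 (C : Submodule (ZMod 2) (Fin 16 → ZMod 2))
    (hdim : 5 ≤ Module.finrank (ZMod 2) C)
    (hwt : ∀ w ∈ C, (Finset.univ.filter fun i => w i ≠ 0).card % 4 = 0 ∧
      (Finset.univ.filter fun i => w i ≠ 0).card ≠ 4) :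
    (fun _ => (1 : ZMod 2)) ∈ C := by
  classical
  by_contra hone
  have : Fintype C := Fintype.ofFinite C
  have hcard : 32 ≤ Fintype.card C := by
    rw [Module.card_eq_pow_finrank (K := ZMod 2) (V := C), ZMod.card]
    exact Nat.pow_le_pow_right (n := 2) (by norm_num) hdim
  let s (w : C) : ℤ := ∑ i, binarySign (w.1 i)
  -- The character sum of a nonzero word is `0` or `-8`, so `s * (s + 8)` vanishes there.
  have hs (w : C) (hw : w ≠ 0) : s w * (s w + 8) = 0 := by
    obtain ⟨hmod, hne_four⟩ := hwt w w.2
    have hle := Finset.card_filter_le (Finset.univ : Finset (Fin 16)) fun i => w.1 i ≠ 0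
    have hne_zero : (Finset.univ.filter fun i => w.1 i ≠ 0).card ≠ 0 := by
      intro h
      rw [Finset.card_eq_zero, Finset.filter_eq_empty_iff] at h
      exact hw (Subtype.ext (funext fun i => not_not.mp (h (Finset.mem_univ i))))
    have hne_full : (Finset.univ.filter fun i => w.1 i ≠ 0).card ≠ 16 := by
      intro h
      have hall := Finset.card_filter_eq_iff.mp (h.trans (Finset.card_fin 16).symm)
      have hw_one : w.1 = fun _ => 1 := funext fun i =>
        (by decide : ∀ x : ZMod 2, x ≠ 0 → x = 1) _ (hall i (Finset.mem_univ i))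
      exact hone (hw_one ▸ w.2)
    rw [Finset.card_fin] at hle
    have hcases : (Finset.univ.filter fun i => w.1 i ≠ 0).card = 8 ∨
        (Finset.univ.filter fun i => w.1 i ≠ 0).card = 12 := by omega
    simp only [s, sum_binarySign_eq]
    rcases hcases with h | h <;> simp [h]
  have htotal : ∑ w, s w * (s w + 8) = 384 := by
    rw [Finset.sum_eq_single 0 (fun w _ => hs w) (by simp)]
    simp [s, binarySign]
  have hfirst : 0 ≤ ∑ w, s w := by
    simp only [s]
    rw [Finset.sum_comm]
    exact Finset.sum_nonneg fun i _ => sum_binarySign_nonneg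
      ((LinearMap.proj i : (Fin 16 → ZMod 2) →ₗ[ZMod 2] ZMod 2) ∘ₗ C.subtype)
  have hsecond : (16 * Fintype.card C : ℤ) ≤ ∑ w, s w ^ 2 := by
    simpa using card_mul_card_le_sum_sq C
  have hsplit : ∑ w, s w * (s w + 8) = ∑ w, s w ^ 2 + 8 * ∑ w, s w := by
    rw [Finset.mul_sum, ← Finset.sum_add_distrib]
    exact Finset.sum_congr rfl fun w _ => by ring
  have hcard' : (32 : ℤ) ≤ Fintype.card C := by exact_mod_cast hcard
  linarith
end

section
/- Equip ℚ^16 with the symmetric bilinear form B(x,y) = −2·∑_{i=1}^{16} x_i y_i, and let Σ = ℤ^16 ⊆ ℚ^16, so that the vectors v ∈ Σ with B(v,v) = −2 are exactly ±e₁, …, ±e₁₆, where e₁, …, e₁₆ is the standard basis. Let M be a subgroup of ℚ^16 containing Σ such that B(x,y) ∈ ℤ for all x, y ∈ M, B(x,x) ∈ 2ℤ for all x ∈ M, the set {v ∈ M : B(v,v) = −2} equals {±e₁, …, ±e₁₆}, and the quotient group M^∨/M can be generated by at most 6 elements, where M^∨ = {x ∈ ℚ^16 : B(x,m) ∈ ℤ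 for all m ∈ M}. Then (e₁ + e₂ + ⋯ + e₁₆)/2 ∈ M. -/
/-- The bilinear form of the negative-definite root lattice `16A₁` on `ℚ^16`. -/
def B16 (x y : Fin 16 → ℚ) : ℚ := -2 * ∑ i, x i * y i

section BinaryCode

variable {ι : Type*}

/-- The nontrivial sign character of `ZMod 2`. -/
def signChar (a : ZMod 2) : ℤ := 1 - 2 * (a.val : ℤ)

lemma signChar_add (a b : ZMod 2) : signChar (a + b) = signChar a * signChar b := by
  revert a b; decide

/-- The Hamming weight of a binary word. -/
def weight [Fintype ι] (c : ι → ZMod 2) : ℕ := ∑ i, (c i).val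

lemma sum_signChar_apply [Fintype ι] (c : ι → ZMod 2) :
    ∑ i, signChar (c i) = Fintype.card ι - 2 * (weight c : ℤ) := by
  simp [signChar, weight, Finset.mul_sum]

lemma eq_zero_of_weight_eq_zero [Fintype ι] {c : ι → ZMod 2} (h : weight c = 0) : c = 0 := by
  funext i
  have := (Finset.sum_eq_zero_iff.mp h) i (Finset.mem_univ i)
  exact (ZMod.val_eq_zero _).mp this

lemma weight_le_card [Fintype ι] (c : ι → ZMod 2) : weight c ≤ Fintype.card ι := by
  have h : weight c ≤ ∑ _i : ι, 1 :=
    Finset.sum_le_sum fun i _ => Nat.le_of_lt_succ (ZMod.val_lt (c i))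
  simpa using h

lemma eq_one_of_weight_eq_card [Fintype ι] {c : ι → ZMod 2} (h : weight c = Fintype.card ι) : c = 1 := by
  have h1 : ∑ i, (c i).val = ∑ _i : ι, 1 := by simpa [weight] using h
  have h2 := (Finset.sum_eq_sum_iff_of_le
    fun i _ => Nat.le_of_lt_succ (ZMod.val_lt (c i))).mp h1
  funext i
  exact (ZMod.val_eq_one one_lt_two _).mp (h2 i (Finset.mem_univ i))

/-- A sum of signs of an additive functional is nonnegative. -/
lemma sum_signChar_nonneg {G : Type*} [AddCommGroup G] [Fintype G] (φ : G →+ ZMod 2) :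
    0 ≤ ∑ g, signChar (φ g) := by
  by_cases h : ∃ g, φ g = 1
  · obtain ⟨g₀, hg₀⟩ := h
    have h1 : ∑ g, signChar (φ g) = ∑ g, signChar (φ (g₀ + g)) :=
      (Equiv.sum_comp (Equiv.addLeft g₀) fun g => signChar (φ g)).symm
    have h2 : ∑ g, signChar (φ (g₀ + g)) = -∑ g, signChar (φ g) := by
      rw [← Finset.sum_neg_distrib]
      refine Finset.sum_congr rfl fun g _ => ?_
      rw [map_add, signChar_add, hg₀, show signChar 1 = -1 by decide, neg_one_mul]
    linarith
  · push Not at h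
    refine Finset.sum_nonneg fun g _ => ?_
    have : ∀ a : ZMod 2, a ≠ 1 → 0 ≤ signChar a := by decide
    exact this _ (h g)

/-- A binary linear code of length 16 all of whose nonzero words have weight 8 or 12 has at most
24 words. -/
lemma card_le_of_weight (C : Submodule (ZMod 2) (Fin 16 → ZMod 2)) [Fintype C]
    (hC : ∀ c ∈ C, c ≠ 0 → weight c = 8 ∨ weight c = 12) : Fintype.card C ≤ 24 := by
  let coord (i : Fin 16) : C →+ ZMod 2 := (Pi.evalAddMonoidHom _ i).comp C.subtype.toAddMonoidHom
  let s (c : C) : ℤ := ∑ i, signChar (c.1 i)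
  have h_lin : 0 ≤ ∑ c, s c := by
    rw [Finset.sum_comm]
    exact Finset.sum_nonneg fun i _ => sum_signChar_nonneg (coord i)
  have h_sq : 16 * (Fintype.card C : ℤ) ≤ ∑ c, s c * s c := by
    have h1 : ∑ c, s c * s c = ∑ i, ∑ j, ∑ c : C, signChar (c.1 i + c.1 j) := by
      simp only [s, Finset.sum_mul_sum, signChar_add]
      rw [Finset.sum_comm]
      exact Finset.sum_congr rfl fun i _ => Finset.sum_comm
    have h2 (i : Fin 16) :
        (Fintype.card C : ℤ) ≤ ∑ j, ∑ c : C, signChar (c.1 i + c.1 j) := by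
      have h3 : ∑ c : C, signChar (c.1 i + c.1 i) = Fintype.card C := by
        simp [CharTwo.add_self_eq_zero, signChar]
      rw [← h3]
      exact Finset.single_le_sum (f := fun j => ∑ c : C, signChar (c.1 i + c.1 j))
        (fun j _ => sum_signChar_nonneg (coord i + coord j)) (Finset.mem_univ i)
    rw [h1]
    calc 16 * (Fintype.card C : ℤ) = ∑ _i : Fin 16, (Fintype.card C : ℤ) := by simp
      _ ≤ _ := Finset.sum_le_sum fun i _ => h2 i
  have h_tot : ∑ c, (s c * s c + 8 * s c) = 384 := by
    rw [Finset.sum_eq_single 0]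
    · simp [s, signChar]
    · intro c _ hc
      have hs : s c = 16 - 2 * (weight c.1 : ℤ) := by
        simpa using sum_signChar_apply c.1
      rcases hC c c.2 (by simpa using hc) with h | h <;> rw [hs, h] <;> norm_num
    · simp
  rw [Finset.sum_add_distrib, ← Finset.mul_sum] at h_tot
  omega

/-- The code orthogonal to `C` under the dot product. -/
def dualCode [Fintype ι] [DecidableEq ι] (C : Submodule (ZMod 2) (ι → ZMod 2)) :
    Submodule (ZMod 2) (ι → ZMod 2) :=
  LinearMap.ker (C.dualRestrict ∘ₗ (dotProductEquiv (ZMod 2) ι).toLinearMap)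

lemma dotProduct_eq_zero_of_mem_dualCode [Fintype ι] [DecidableEq ι] {C : Submodule (ZMod 2) (ι → ZMod 2)}
    {d c : ι → ZMod 2} (hd : d ∈ dualCode C) (hc : c ∈ C) : d ⬝ᵥ c = 0 :=
  LinearMap.congr_fun (LinearMap.mem_ker.mp hd) (⟨c, hc⟩ : C)

lemma two_pow_card_le [Fintype ι] [DecidableEq ι] (C : Submodule (ZMod 2) (ι → ZMod 2)) :
    2 ^ Fintype.card ι ≤ Nat.card C * Nat.card (dualCode C) := by
  have h := LinearMap.finrank_range_add_finrank_ker
    (C.dualRestrict ∘ₗ (dotProductEquiv (ZMod 2) ι).toLinearMap)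
  have h' := Submodule.finrank_le (LinearMap.range
    (C.dualRestrict ∘ₗ (dotProductEquiv (ZMod 2) ι).toLinearMap))
  rw [Subspace.dual_finrank_eq] at h'
  rw [Module.finrank_fintype_fun_eq_card] at h
  rw [Module.natCard_eq_pow_finrank (K := ZMod 2) (V := C),
    Module.natCard_eq_pow_finrank (K := ZMod 2) (V := dualCode C), Nat.card_zmod, ← pow_add]
  refine Nat.pow_le_pow_right two_pos ?_
  unfold dualCode
  omega

/-- The vector with entries `0` and `1/2` attached to a binary word. -/
def halfLift (c : ι → ZMod 2) : ι → ℚ := fun i => ((c i).val : ℚ) / 2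

lemma halfLift_add (a b : ι → ZMod 2) :
    halfLift (a + b) = halfLift a + halfLift b -
      fun i => (((a i).val * (b i).val : ℤ) : ℚ) := by
  have key : ∀ x y : ZMod 2, ((x + y).val : ℤ) = x.val + y.val - 2 * (x.val * y.val) := by decide
  funext i
  have := congrArg (Int.cast : ℤ → ℚ) (key (a i) (b i))
  push_cast at this
  simp only [halfLift, Pi.add_apply, Pi.sub_apply]
  push_cast
  linarith

/-- Half an integral vector differs from the half-lift of its reduction by an integral vector. -/
lemma half_eq_halfLift_add (v : ι → ℤ) :
    (fun i => (v i : ℚ) / 2) = halfLift (fun i => (v i : ZMod 2)) +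
      fun i => ((v i / 2 : ℤ) : ℚ) := by
  funext i
  have h : (((v i : ZMod 2).val : ℤ)) + 2 * (v i / 2) = v i := by
    rw [ZMod.val_intCast]
    exact Int.emod_add_mul_ediv (v i) 2
  have := congrArg (Int.cast : ℤ → ℚ) h
  push_cast at this
  simp only [halfLift, Pi.add_apply]
  linarith

/-- The binary code of the vectors of `M` with entries in `{0, 1/2}`. -/
def latticeCode (M : Submodule ℤ (ι → ℚ)) (hM : ∀ v : ι → ℤ, (fun i => (v i : ℚ)) ∈ M) :
    Submodule (ZMod 2) (ι → ZMod 2) where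
  carrier := {c | halfLift c ∈ M}
  zero_mem' := by
    have : halfLift (0 : ι → ZMod 2) = 0 := by funext i; simp [halfLift]
    simp [this]
  add_mem' {a b} ha hb := by
    simp only [Set.mem_ofPred_eq, halfLift_add] at *
    exact M.sub_mem (M.add_mem ha hb) (hM fun i => (a i).val * (b i).val)
  smul_mem' r c hc := by
    have hr : r = 0 ∨ r = 1 := by revert r; decide
    rcases hr with rfl | rfl
    · have : halfLift (0 : ι → ZMod 2) = 0 := by funext i; simp [halfLift]
      simp [this]
    · simpa using hc

end BinaryCode

lemma B16_single_right (x : Fin 16 → ℚ) (i : Fin 16) : B16 x (Pi.single i 1) = -2 * x i := by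
  simp [B16, Pi.single_apply]

lemma B16_halfLift_self (c : Fin 16 → ZMod 2) :
    B16 (halfLift c) (halfLift c) = -(weight c : ℚ) / 2 := by
  have key : ∀ a : ZMod 2, a.val * a.val = a.val := by decide
  have h (i : Fin 16) : halfLift c i * halfLift c i = ((c i).val : ℚ) / 4 := by
    have := congrArg (Nat.cast : ℕ → ℚ) (key (c i))
    push_cast at this
    simp only [halfLift]
    linarith
  simp only [B16, h, ← Finset.sum_div, weight]
  push_cast
  ring

/-- A vector pairing integrally with an overlattice of `ℤ^16` is half-integral. -/
lemma exists_eq_half {M : Submodule ℤ (Fin 16 → ℚ)}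
    (hcont : ∀ v : Fin 16 → ℤ, (fun i => (v i : ℚ)) ∈ M) {x : Fin 16 → ℚ}
    (hx : ∀ m ∈ M, ∃ n : ℤ, B16 x m = n) :
    ∃ v : Fin 16 → ℤ, x = fun i => (v i : ℚ) / 2 := by
  have hsingle (i : Fin 16) : (Pi.single i 1 : Fin 16 → ℚ) ∈ M := by
    convert hcont (Pi.single i 1) using 1
    funext j
    by_cases h : j = i <;> simp [h]
  choose n hn using fun i => hx _ (hsingle i)
  refine ⟨fun i => -n i, funext fun i => ?_⟩
  have := hn i
  rw [B16_single_right] at this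
  push_cast
  linarith

/-- Half-lifts of words orthogonal to the code of `M` pair integrally with `M`. -/
lemma B16_halfLift_integral {M : Submodule ℤ (Fin 16 → ℚ)}
    (hcont : ∀ v : Fin 16 → ℤ, (fun i => (v i : ℚ)) ∈ M)
    (hint : ∀ x ∈ M, ∀ y ∈ M, ∃ n : ℤ, B16 x y = n) {d : Fin 16 → ZMod 2}
    (hd : d ∈ dualCode (latticeCode M hcont)) :
    ∀ m ∈ M, ∃ n : ℤ, B16 (halfLift d) m = n := by
  intro m hm
  obtain ⟨v, rfl⟩ := exists_eq_half hcont (hint m hm)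
  have hv : (fun i => (v i : ZMod 2)) ∈ latticeCode M hcont := by
    change halfLift _ ∈ M
    rw [half_eq_halfLift_add] at hm
    exact (M.add_mem_iff_left (hcont fun i => v i / 2)).mp hm
  have h0 := dotProduct_eq_zero_of_mem_dualCode hd hv
  have h1 : ((∑ i, ((d i).val : ℤ) * v i : ℤ) : ZMod 2) = 0 := by
    simpa [dotProduct] using h0
  obtain ⟨k, hk⟩ := (ZMod.intCast_zmod_eq_zero_iff_dvd _ 2).mp h1
  refine ⟨-k, ?_⟩
  have hk' := congrArg (Int.cast : ℤ → ℚ) hk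
  push_cast at hk'
  have h2 (i : Fin 16) : halfLift d i * ((v i : ℚ) / 2) = ((d i).val : ℚ) * v i / 4 := by
    simp only [halfLift]; ring
  simp only [B16, h2, ← Finset.sum_div, hk']
  push_cast
  ring

/-- If the discriminant group of `M` has at most 6 generators, the code of `M` has index at most
`64` in its dual. -/
lemma card_dualCode_le {M : Submodule ℤ (Fin 16 → ℚ)}
    (hcont : ∀ v : Fin 16 → ℤ, (fun i => (v i : ℚ)) ∈ M)
    (hint : ∀ x ∈ M, ∀ y ∈ M, ∃ n : ℤ, B16 x y = n)
    (hlen : ∃ g : Fin 6 → (Fin 16 → ℚ),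
      (∀ k, ∀ m ∈ M, ∃ n : ℤ, B16 (g k) m = n) ∧
      ∀ x : Fin 16 → ℚ, (∀ m ∈ M, ∃ n : ℤ, B16 x m = n) →
        ∃ c : Fin 6 → ℤ, x - ∑ k, c k • g k ∈ M) :
    Nat.card (dualCode (latticeCode M hcont)) ≤ Nat.card (latticeCode M hcont) * 64 := by
  classical
  set C := latticeCode M hcont
  obtain ⟨g, hg, hgen⟩ := hlen
  have htwo (k : Fin 6) : (2 : ℤ) • g k ∈ M := by
    obtain ⟨v, hv⟩ := exists_eq_half hcont (hg k)
    convert hcont v using 1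
    funext i
    simp [hv]
    ring
  choose a ha using fun d : dualCode C => hgen _ (B16_halfLift_integral hcont hint d.2)
  let f (d : dualCode C) : Fin 6 → ZMod 2 := fun k => a d k
  have hf {d d' : dualCode C} (h : f d = f d') : d.1 - d'.1 ∈ C := by
    have hdvd (k : Fin 6) : ∃ e : ℤ, a d k - a d' k = 2 * e := by
      have h1 : ((a d k - a d' k : ℤ) : ZMod 2) = 0 := by
        push_cast
        exact sub_eq_zero.mpr (congrFun h k)
      exact (ZMod.intCast_zmod_eq_zero_iff_dvd _ 2).mp h1
    choose e he using hdvd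
    have hsum : ∑ k, a d k • g k - ∑ k, a d' k • g k ∈ M := by
      rw [← Finset.sum_sub_distrib]
      refine M.sum_mem fun k _ => ?_
      rw [← sub_smul, he, mul_comm, mul_smul]
      exact M.smul_mem _ (htwo k)
    have hsub : halfLift d.1 - halfLift d'.1 ∈ M := by
      convert M.add_mem (M.sub_mem (ha d) (ha d')) hsum using 1
      abel
    have heq : d.1 = (d.1 - d'.1) + d'.1 := by abel
    have h3 := halfLift_add (d.1 - d'.1) d'.1
    rw [← heq] at h3
    change halfLift (d.1 - d'.1) ∈ M
    convert M.add_mem hsub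
      (hcont fun i => ((d.1 - d'.1) i).val * (d'.1 i).val) using 1
    rw [h3]
    abel
  have hfib : ∀ b ∈ (Finset.univ : Finset (Fin 6 → ZMod 2)),
      (Finset.univ.filter fun d => f d = b).card ≤ Fintype.card C := by
    intro b _
    rcases (Finset.univ.filter fun d => f d = b).eq_empty_or_nonempty with h | ⟨d₀, hd₀⟩
    · simp [h]
    · rw [← Finset.card_univ]
      refine Finset.card_le_card_of_injOn
        (fun d => if h : f d = f d₀ then ⟨d.1 - d₀.1, hf h⟩ else 0) (by simp) ?_
      intro d hd d' hd' h
      simp only [Finset.coe_filter, Finset.mem_univ, true_and, Set.mem_ofPred_eq,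
        Finset.mem_filter] at hd hd' hd₀
      have hd₁ : f d = f d₀ := hd.trans hd₀.symm
      have hd₁' : f d' = f d₀ := hd'.trans hd₀.symm
      simp only [dif_pos hd₁, dif_pos hd₁'] at h
      exact Subtype.ext (sub_left_injective (congrArg Subtype.val h))
  have := Finset.card_le_mul_card_image_of_maps_to (s := Finset.univ) (f := f)
    (fun d _ => Finset.mem_univ _) _ hfib
  rw [Nat.card_eq_fintype_card, Nat.card_eq_fintype_card]
  simpa [ZMod.card] using this

/-- The code of an even overlattice of `ℤ^16` without further roots has weights
`0`, `8`, `12` and `16` only. -/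
lemma weight_of_mem_latticeCode {M : Submodule ℤ (Fin 16 → ℚ)}
    (hcont : ∀ v : Fin 16 → ℤ, (fun i => (v i : ℚ)) ∈ M)
    (heven : ∀ x ∈ M, ∃ n : ℤ, B16 x x = 2 * n)
    (hroots : ∀ v : Fin 16 → ℚ, (v ∈ M ∧ B16 v v = -2) ↔
      ∃ i : Fin 16, v = Pi.single i 1 ∨ v = -Pi.single i 1)
    {c : Fin 16 → ZMod 2} (hc : c ∈ latticeCode M hcont) :
    weight c = 0 ∨ weight c = 8 ∨ weight c = 12 ∨ weight c = 16 := by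
  obtain ⟨n, hn⟩ := heven _ hc
  rw [B16_halfLift_self] at hn
  have h4 : (weight c : ℤ) = -4 * n := by
    have : (weight c : ℚ) = -4 * n := by linarith
    exact_mod_cast this
  have hle : weight c ≤ 16 := by simpa using weight_le_card c
  have hne : weight c ≠ 4 := by
    intro h
    obtain ⟨i, hi⟩ := (hroots (halfLift c)).mp ⟨hc, by rw [B16_halfLift_self, h]; norm_num⟩
    have hval : (c i).val = 0 ∨ (c i).val = 1 := by
      have := ZMod.val_lt (c i)
      omega
    have hi' : halfLift c i = 1 ∨ halfLift c i = -1 := by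
      rcases hi with hi | hi <;> simp [hi]
    rcases hval with h | h <;> simp only [halfLift, h] at hi' <;> norm_num at hi'
  omega

/-- If `M` is an even overlattice of the root lattice `Σ = ℤ^16` of type `16A₁` whose
roots are exactly `±e₁, …, ±e₁₆` and whose discriminant group `M^∨/M` can be generated by
at most 6 elements, then `(e₁ + ⋯ + e₁₆)/2 ∈ M`. -/
theorem stmt11 (M : Submodule ℤ (Fin 16 → ℚ))
    (hcont : ∀ v : Fin 16 → ℤ, (fun i => (v i : ℚ)) ∈ M)
    (hint : ∀ x ∈ M, ∀ y ∈ M, ∃ n : ℤ, B16 x y = n)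
    (heven : ∀ x ∈ M, ∃ n : ℤ, B16 x x = 2 * n)
    (hroots : ∀ v : Fin 16 → ℚ, (v ∈ M ∧ B16 v v = -2) ↔
      ∃ i : Fin 16, v = Pi.single i 1 ∨ v = -Pi.single i 1)
    (hlen : ∃ g : Fin 6 → (Fin 16 → ℚ),
      (∀ k, ∀ m ∈ M, ∃ n : ℤ, B16 (g k) m = n) ∧
      ∀ x : Fin 16 → ℚ, (∀ m ∈ M, ∃ n : ℤ, B16 x m = n) →
        ∃ c : Fin 6 → ℤ, x - ∑ k, c k • g k ∈ M) :
    (fun _ => (1 / 2 : ℚ)) ∈ M := by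
  classical
  by_contra hM
  have hone : (1 : Fin 16 → ZMod 2) ∉ latticeCode M hcont := by
    intro h
    refine hM ?_
    convert (show halfLift (1 : Fin 16 → ZMod 2) ∈ M from h) using 1
    funext i
    simp [halfLift, ZMod.val_one]
  have hsmall : Fintype.card (latticeCode M hcont) ≤ 24 := by
    refine card_le_of_weight _ fun c hc hc0 => ?_
    rcases weight_of_mem_latticeCode hcont heven hroots hc with h | h | h | h
    · exact absurd (eq_zero_of_weight_eq_zero h) hc0
    · exact Or.inl h
    · exact Or.inr h
    · have h1 : c = 1 := eq_one_of_weight_eq_card (by rw [h, Fintype.card_fin])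
      exact absurd (h1 ▸ hc) hone
  have hdual := two_pow_card_le (latticeCode M hcont)
  have hindex := card_dualCode_le hcont hint hlen
  rw [← Nat.card_eq_fintype_card] at hsmall
  rw [Fintype.card_fin] at hdual
  nlinarith
end
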